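/- arXiv:1406.2510 — 2 statements merged into one kernel-verified Lean document; each statement's English description precedes it below -/
import Mathlib

section
/- Let S be a skew lattice. Then: (i) S is left quasi normal, i.e. satisfies the identity a∧x∧y = a∧x∧a∧y, if and only if for all D-classes A > B in S and all x, x' ∈ B with x R x' one has x∧A = x'∧A; (ii) S is right quasi normal, i.e. satisfies the identity y∧x∧a = y∧a∧x∧a, if and only if for all D-classes A > B in S and all x, x' ∈ B with x L x' one has A∧x = A∧x'. -/
/-- A skew lattice: a set with two idempotent associative operations
satisfying the absorption laws. -/
class SkewLattice (S : Type*) where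
  meet : S → S → S
  join : S → S → S
  meet_assoc : ∀ x y z : S, meet (meet x y) z = meet x (meet y z)
  join_assoc : ∀ x y z : S, join (join x y) z = join x (join y z)
  meet_idem : ∀ x : S, meet x x = x
  join_idem : ∀ x : S, join x x = x
  absorb₁ : ∀ x y : S, meet x (join x y) = x
  absorb₂ : ∀ x y : S, meet (join y x) x = x
  absorb₃ : ∀ x y : S, join x (meet x y) = x
  absorb₄ : ∀ x y : S, join (meet y x) x = x

namespace SkewLattice

variable {S : Type*} [SkewLattice S]

local infixl:70 " ∧' " => SkewLattice.meet
local infixl:65 " ∨' " => SkewLattice.join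

/-- The flat preorder `≤_L`: `x ≤_L y` iff `x ∧ y = x`. -/
def leqL (x y : S) : Prop := x ∧' y = x

/-- The flat preorder `≤_R`: `x ≤_R y` iff `y ∧ x = x`. -/
def leqR (x y : S) : Prop := y ∧' x = x

/-- Green's relation `R`. -/
def relR (x y : S) : Prop := x ∧' y = y ∧ y ∧' x = x

/-- Green's relation `L`. -/
def relL (x y : S) : Prop := x ∧' y = x ∧ y ∧' x = y

/-- Green's relation `D`. -/
def relD (x y : S) : Prop := x ∧' y ∧' x = x ∧ y ∧' x ∧' y = y

/-- The natural preorder `⪯`. -/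
def preceq (x y : S) : Prop := x ∧' y ∧' x = x

/-- A `D`-class: an equivalence class of Green's relation `D`. -/
def IsDClass (A : Set S) : Prop := ∃ a : S, A = {x | relD x a}

/-- `A > B` for `D`-classes: `A` and `B` are `D`-classes with every element of `B`
strictly below every element of `A` in the natural preorder. -/
def classGT (A B : Set S) : Prop :=
  IsDClass A ∧ IsDClass B ∧ ∀ a ∈ A, ∀ b ∈ B, preceq b a ∧ ¬ preceq a b

/-- A skew diamond `{J > A, B > M}`: two incomparable `D`-classes `A`, `B`
together with the `D`-class `M` of `a ∧ b ∧ a` and the `D`-class `J` of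
`a ∨ b ∨ a` for some `a ∈ A`, `b ∈ B`. -/
def IsSkewDiamond (J A B M : Set S) : Prop :=
  IsDClass J ∧ IsDClass A ∧ IsDClass B ∧ IsDClass M ∧
  (∀ a ∈ A, ∀ b ∈ B, ¬ preceq a b ∧ ¬ preceq b a) ∧
  ∃ a ∈ A, ∃ b ∈ B, (a ∧' b ∧' a) ∈ M ∧ (a ∨' b ∨' a) ∈ J

theorem band_trans {T : Type*} (m : T → T → T) (as : ∀ x y z, m (m x y) z = m x (m y z))
    (id : ∀ x, m x x = x) {x y z : T} (h1 : m (m x y) x = x) (h2 : m (m y z) y = y) :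
    m (m x z) x = x := by
  have e : m (m x y) (m z (m y x)) = x := by
    calc m (m x y) (m z (m y x)) = m (m x (m (m y z) y)) x := by simp only [as]
      _ = x := by rw [h2, h1]
  have e2 : m (m (m x y) z) x = x := by
    have e' : m (m (m x y) z) (m y x) = x := by rw [as]; exact e
    generalize m (m x y) z = p at e'
    generalize m y x = q at e'
    rw [← e', ← as, id]
  have e3 : m x (m z x) = x := by
    have : m (m x y) (m z x) = x := by rw [← as]; exact e2
    calc m x (m z x) = m (m (m x y) (m z x)) (m z x) := by rw [this]
      _ = x := by rw [as, id, this]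
  rw [as, e3]

theorem preceq_trans' {x y z : S} (h1 : preceq x y) (h2 : preceq y z) : preceq x z :=
  band_trans meet meet_assoc meet_idem h1 h2

theorem preceq_join {x y : S} (h : preceq x y) : y ∨' x ∨' y = y := by
  have h' : x ∧' y ∧' x = x := h
  apply band_trans join join_assoc join_idem (y := y ∧' x)
  · rw [absorb₃, join_idem]
  · have a1 : (y ∧' x) ∨' x = x := absorb₄ x y
    have a2 : x ∨' (y ∧' x) = y ∧' x := by
      have := absorb₄ (y ∧' x) x
      rwa [← meet_assoc, h'] at this
    rw [a1, a2]

theorem keyL {w x x' : S} (hw : preceq w x) (h : relL x x') : w ∧' x = w ∧' x' := by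
  obtain ⟨h1, h2⟩ := h
  have j := preceq_join hw
  have w1 : w ∧' (w ∨' x) = w := absorb₁ w x
  have n1 : (w ∨' x) ∧' x = x := absorb₂ x w
  have n2 : x ∧' (w ∨' x) = w ∨' x := by
    have := absorb₂ (w ∨' x) x
    rwa [← join_assoc, j] at this
  generalize w ∨' x = n at w1 n1 n2
  have p : n ∧' x' ∧' n = n := by
    apply preceq_trans' (y := x)
    · show n ∧' x ∧' n = n
      rw [n1, n2]
    · show x ∧' x' ∧' x = x
      rw [h1, meet_idem]
  have q : n ∧' x' = x := by
    calc n ∧' x' = n ∧' x' ∧' x := by rw [meet_assoc, h2]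
      _ = n ∧' x' ∧' (n ∧' x) := by rw [n1]
      _ = x := by rw [← meet_assoc, p, n1]
  calc w ∧' x = w ∧' (n ∧' x') := by rw [q]
    _ = w ∧' x' := by rw [← meet_assoc, w1]

/-- The opposite skew lattice. -/
@[reducible] def opp (S : Type*) [SkewLattice S] : SkewLattice S where
  meet x y := y ∧' x
  join x y := y ∨' x
  meet_assoc x y z := (meet_assoc z y x).symm
  join_assoc x y z := (join_assoc z y x).symm
  meet_idem := meet_idem
  join_idem := join_idem
  absorb₁ x y := absorb₂ x y
  absorb₂ x y := absorb₁ x y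
  absorb₃ x y := absorb₄ x y
  absorb₄ x y := absorb₃ x y

theorem preceq_opp {x y : S} : @preceq S (opp S) x y ↔ preceq x y := by
  show x ∧' (y ∧' x) = x ↔ x ∧' y ∧' x = x
  rw [meet_assoc]

theorem relD_opp {x y : S} : @relD S (opp S) x y ↔ relD x y := by
  show (x ∧' (y ∧' x) = x ∧ y ∧' (x ∧' y) = y) ↔ (x ∧' y ∧' x = x ∧ y ∧' x ∧' y = y)
  rw [meet_assoc, meet_assoc]

theorem relL_opp {x y : S} : @relL S (opp S) x y ↔ relR x y := and_comm
theorem relR_opp {x y : S} : @relR S (opp S) x y ↔ relL x y := and_comm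

theorem isDClass_opp {A : Set S} : @IsDClass S (opp S) A ↔ IsDClass A := by
  simp only [IsDClass, relD_opp]

theorem classGT_opp {A B : Set S} : @classGT S (opp S) A B ↔ classGT A B := by
  simp only [classGT, preceq_opp, isDClass_opp]

theorem keyR {w x x' : S} (hw : preceq w x) (h : relR x x') : x ∧' w = x' ∧' w :=
  @keyL S (opp S) w x x' (preceq_opp.2 hw) (relL_opp.2 h)

theorem part_one (S : Type*) [SkewLattice S] :
    ((∀ a x y : S, a ∧' x ∧' y = a ∧' x ∧' a ∧' y) ↔
      (∀ A B : Set S, classGT A B → ∀ x ∈ B, ∀ x' ∈ B, relR x x' →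
        {z : S | ∃ w ∈ A, z = x ∧' w} = {z : S | ∃ w ∈ A, z = x' ∧' w})) := by
  constructor
  · intro H A B _ x _ x' _ hR
    have : ∀ w, x ∧' w = x' ∧' w := by
      intro w
      have := H x' x w
      rwa [hR.2, hR.1] at this
    simp only [this]
  · intro H a x y
    obtain ⟨u, hu⟩ : ∃ u, u = a ∧' x ∧' y := ⟨_, rfl⟩
    obtain ⟨v, hv⟩ : ∃ v, v = a ∧' x ∧' a ∧' y := ⟨_, rfl⟩
    rw [← hu, ← hv]
    have hR : relR (a ∧' x) (a ∧' x ∧' a) := by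
      constructor
      · rw [← meet_assoc, meet_idem]
      · rw [meet_assoc (a ∧' x) a, ← meet_assoc a a x, meet_idem, meet_idem]
    have idl : ∀ s t : S, s ∧' (s ∧' t) = s ∧' t := fun s t => by rw [← meet_assoc, meet_idem]
    have below : ∀ p q r : S, preceq (p ∧' q ∧' r) q := by
      intro p q r
      apply preceq_trans' (y := q ∧' r)
      · show p ∧' q ∧' r ∧' (q ∧' r) ∧' (p ∧' q ∧' r) = p ∧' q ∧' r
        rw [meet_assoc p q r, meet_assoc p (q ∧' r) (q ∧' r), meet_idem, meet_idem]
      · show q ∧' r ∧' q ∧' (q ∧' r) = q ∧' r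
        rw [meet_assoc (q ∧' r), idl, meet_idem]
    have vu : v ∧' u = u := by
      have := keyR (below y (a ∧' x) y) hR
      calc v ∧' u = a ∧' x ∧' a ∧' (y ∧' (a ∧' x) ∧' y) := by rw [hu, hv]; simp only [meet_assoc]
        _ = a ∧' x ∧' (y ∧' (a ∧' x) ∧' y) := this.symm
        _ = a ∧' x ∧' y ∧' (a ∧' x ∧' y) := by simp only [meet_assoc]
        _ = u := by rw [meet_idem, hu]
    have uv : u ∧' v = v := by
      have := keyR (below y (a ∧' x) (a ∧' y)) hR
      calc u ∧' v = a ∧' x ∧' (y ∧' (a ∧' x) ∧' (a ∧' y)) := by rw [hu, hv]; simp only [meet_assoc]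
        _ = a ∧' x ∧' a ∧' (y ∧' (a ∧' x) ∧' (a ∧' y)) := this
        _ = a ∧' x ∧' a ∧' y ∧' (a ∧' x ∧' a ∧' y) := by simp only [meet_assoc]
        _ = v := by rw [meet_idem, hv]
    have uy : u ∧' y = u := by rw [hu, meet_assoc, meet_idem]
    have vy : v ∧' y = v := by rw [hv, meet_assoc, meet_idem]
    have huy : preceq u y := by show u ∧' y ∧' u = u; rw [uy, meet_idem]
    have hvy : preceq v y := by show v ∧' y ∧' v = v; rw [vy, meet_idem]
    by_cases hyu : preceq y u
    · have e : y ∧' u = y := by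
        have e : y ∧' u ∧' y = y := hyu
        rwa [meet_assoc, uy] at e
      calc u = v ∧' u := vu.symm
        _ = v ∧' y ∧' u := by rw [vy]
        _ = v := by rw [meet_assoc, e, vy]
    · have gt : classGT {z | relD z y} {z | relD z u} := by
        refine ⟨⟨y, rfl⟩, ⟨u, rfl⟩, ?_⟩
        rintro c ⟨c1, c2⟩ b ⟨b1, b2⟩
        exact ⟨preceq_trans' b1 (preceq_trans' huy c2), fun h =>
          hyu (preceq_trans' c2 (preceq_trans' h b1))⟩
      have dU : relD u u := by
        constructor <;> rw [meet_idem, meet_idem]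
      have dY : relD y y := by
        constructor <;> rw [meet_idem, meet_idem]
      have dV : relD v u := by
        constructor
        · rw [vu, uv]
        · rw [uv, vu]
      have E := H _ _ gt u dU v dV ⟨uv, vu⟩
      have M : u ∈ {z : S | ∃ w ∈ {z | relD z y}, z = u ∧' w} := ⟨y, dY, uy.symm⟩
      rw [E] at M
      obtain ⟨w, ⟨_, w2⟩, e⟩ := M
      have k : v ∧' y = v ∧' (w ∧' y) := keyL hvy ⟨by rw [← meet_assoc, w2], by
        rw [meet_assoc, meet_idem]⟩
      calc u = u ∧' y := uy.symm
        _ = v ∧' w ∧' y := by rw [← e]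
        _ = v := by rw [meet_assoc, ← k, vy]

/-- coset characterizations of left and right quasi normality. -/
theorem quasi_normal_iff_coset_law :
    ((∀ a x y : S, a ∧' x ∧' y = a ∧' x ∧' a ∧' y) ↔
      (∀ A B : Set S, classGT A B → ∀ x ∈ B, ∀ x' ∈ B, relR x x' →
        {z : S | ∃ w ∈ A, z = x ∧' w} = {z : S | ∃ w ∈ A, z = x' ∧' w})) ∧
    ((∀ a x y : S, y ∧' x ∧' a = y ∧' a ∧' x ∧' a) ↔
      (∀ A B : Set S, classGT A B → ∀ x ∈ B, ∀ x' ∈ B, relL x x' →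
        {z : S | ∃ w ∈ A, z = w ∧' x} = {z : S | ∃ w ∈ A, z = w ∧' x'})) := by
  refine ⟨part_one S, ?_⟩
  have h := @part_one S (opp S)
  simp only [classGT_opp, relR_opp] at h
  refine Iff.trans ?_ h
  show _ ↔ ∀ a x y : S, y ∧' (x ∧' a) = y ∧' (a ∧' (x ∧' a))
  simp only [meet_assoc]

end SkewLattice
end

section
/- Let S be a skew lattice and let {J > A, B > M} be a skew diamond in S. Then for all x, x' ∈ A: (i) if M∨x = M∨x' then B∨x = B∨x'; (ii) if x∧J = x'∧J then x∧B = x'∧B. -/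
namespace SkewLattice

variable {S : Type*} [SkewLattice S]

local infixl:70 " ∧' " => SkewLattice.meet
local infixl:65 " ∨' " => SkewLattice.join

theorem aux_meet {x u z v : S} (h : x = u ∧' z ∧' v) : preceq x z := by
  have h1 : x ∧' z ∧' v = x := by
    rw [h]
    simp only [meet_assoc]
    have := meet_idem (z ∧' v)
    rw [meet_assoc] at this
    rw [this]
  unfold preceq
  calc x ∧' z ∧' x = x ∧' z ∧' (x ∧' z ∧' v) := by rw [h1]
    _ = (x ∧' z) ∧' (x ∧' z) ∧' v := by simp only [meet_assoc]
    _ = x := by rw [meet_idem, h1]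

theorem aux_join {x u z v : S} (h : x = u ∨' z ∨' v) : x ∨' z ∨' x = x := by
  have h1 : x ∨' z ∨' v = x := by
    rw [h]
    simp only [join_assoc]
    have := join_idem (z ∨' v)
    rw [join_assoc] at this
    rw [this]
  calc x ∨' z ∨' x = x ∨' z ∨' (x ∨' z ∨' v) := by rw [h1]
    _ = (x ∨' z) ∨' (x ∨' z) ∨' v := by simp only [join_assoc]
    _ = x := by rw [join_idem, h1]

theorem aux_trans {x y z : S} (h : preceq x y) (h' : preceq y z) : preceq x z := by
  unfold preceq at h h'
  apply aux_meet (u := x ∧' y) (v := y ∧' x)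
  calc x = x ∧' (y ∧' z ∧' y) ∧' x := by rw [h', h]
    _ = _ := by simp only [meet_assoc]

theorem aux_D {x y : S} : relD x y ↔ preceq x y ∧ preceq y x := Iff.rfl

theorem aux_dual {m b : S} (h : preceq m b) : b ∨' m ∨' b = b := by
  unfold preceq at h
  have h1 : m ∨' (b ∧' m) = b ∧' m := by
    have := absorb₄ (b ∧' m) m
    rwa [← meet_assoc, h] at this
  apply aux_join (u := b) (v := b ∧' m)
  rw [join_assoc, h1, absorb₃]

theorem aux_joinR {m b : S} (h : preceq m b) : relD (b ∨' m) b := by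
  have h2 : (b ∨' m) ∧' b = b ∨' m := by
    have := absorb₁ (b ∨' m) b
    rwa [aux_dual h] at this
  constructor
  · rw [h2, meet_idem]
  · rw [absorb₁, meet_idem]

theorem aux_joinL {m b : S} (h : preceq m b) : relD (m ∨' b) b := by
  have h2 : b ∧' (m ∨' b) = m ∨' b := by
    have := absorb₂ (m ∨' b) b
    rwa [← join_assoc, aux_dual h] at this
  constructor
  · rw [meet_assoc, h2, meet_idem]
  · rw [h2, absorb₂]

theorem aux_meetL {j b : S} (h : preceq b j) : relD (j ∧' b) b := by
  unfold preceq at h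
  constructor
  · rw [meet_assoc j b b, meet_idem, meet_idem]
  · rw [← meet_assoc, h, meet_idem]

theorem aux_conj {m x : S} (h : preceq m x) : relD (x ∧' m ∧' x) m := by
  refine ⟨aux_meet (u := x) (v := x) rfl, ?_⟩
  unfold preceq at h
  calc m ∧' (x ∧' m ∧' x) ∧' m = (m ∧' x ∧' m) ∧' x ∧' m := by simp only [meet_assoc]
    _ = m := by rw [h, h]

theorem aux_Dtrans {x y z : S} (h : relD x y) (h' : relD y z) : relD x z :=
  ⟨aux_trans h.1 h'.1, aux_trans h'.2 h.2⟩

theorem aux_class {A : Set S} (h : IsDClass A) {x y : S} (hx : x ∈ A) (hy : relD y x) : y ∈ A := by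
  obtain ⟨a, rfl⟩ := h
  exact aux_Dtrans hy hx

theorem aux_class' {A : Set S} (h : IsDClass A) {x y : S} (hx : x ∈ A) (hy : y ∈ A) :
    preceq x y := by
  obtain ⟨a, rfl⟩ := h
  exact aux_trans hx.1 hy.2

theorem aux_lift {A B : Set S} (hA : IsDClass A) (hB : IsDClass B) {a b x y : S}
    (ha : a ∈ A) (hb : b ∈ B) (h : preceq a b) (hx : x ∈ A) (hy : y ∈ B) : preceq x y :=
  aux_trans (aux_class' hA hx ha) (aux_trans h (aux_class' hB hb hy))

/-- in any skew diamond `{J > A, B > M}`, equality of `M`-cosets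
implies equality of `B`-cosets, and equality of `J`-cosets implies equality
of `B`-cosets. -/
theorem diamond_coset_implications (J A B M : Set S)
    (h : IsSkewDiamond J A B M) (x x' : S) (hx : x ∈ A) (hx' : x' ∈ A) :
    ({z : S | ∃ m ∈ M, z = m ∨' x} = {z : S | ∃ m ∈ M, z = m ∨' x'} →
      {z : S | ∃ b ∈ B, z = b ∨' x} = {z : S | ∃ b ∈ B, z = b ∨' x'}) ∧
    ({z : S | ∃ j ∈ J, z = x ∧' j} = {z : S | ∃ j ∈ J, z = x' ∧' j} →
      {z : S | ∃ b ∈ B, z = x ∧' b} = {z : S | ∃ b ∈ B, z = x' ∧' b}) := by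
  obtain ⟨hJ, hA, hB, hM, -, a, ha, b, hb, hm, hj⟩ := h
  have MA : ∀ m ∈ M, ∀ y ∈ A, preceq m y := fun m hm' y hy =>
    aux_lift hM hA hm ha (aux_meet (u := a ∧' b) (z := a) (v := a)
      (by rw [meet_assoc _ a a, meet_idem])) hm' hy
  have MB : ∀ m ∈ M, ∀ y ∈ B, preceq m y := fun m hm' y hy =>
    aux_lift hM hB hm hb (aux_meet (u := a) (v := a) rfl) hm' hy
  have AJ : ∀ y ∈ A, ∀ j ∈ J, preceq y j := fun y hy j hj' =>
    aux_lift hA hJ ha hj (by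
      unfold preceq
      rw [join_assoc, absorb₁, meet_idem]) hy hj'
  have BJ : ∀ y ∈ B, ∀ j ∈ J, preceq y j := fun y hy j hj' =>
    aux_lift hB hJ hb hj (aux_meet (u := b) (v := b ∨' a) (by
      rw [meet_assoc, join_assoc, absorb₂, absorb₁])) hy hj'
  have key1 : ∀ x ∈ A, ∀ x' ∈ A,
      {z : S | ∃ m ∈ M, z = m ∨' x} = {z : S | ∃ m ∈ M, z = m ∨' x'} →
      {z : S | ∃ b ∈ B, z = b ∨' x'} ⊆ {z : S | ∃ b ∈ B, z = b ∨' x} := by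
    rintro x hx x' hx' h z ⟨c, hc, rfl⟩
    have h1 : x' ∈ {z : S | ∃ m ∈ M, z = m ∨' x'} :=
      ⟨_, aux_class hM hm (aux_conj (MA _ hm x' hx')), (absorb₄ _ _).symm⟩
    rw [← h] at h1
    obtain ⟨m, hm', e⟩ := h1
    exact ⟨c ∨' m, aux_class hB hc (aux_joinR (MB m hm' c hc)), by rw [join_assoc, ← e]⟩
  have key2 : ∀ x ∈ A, ∀ x' ∈ A,
      {z : S | ∃ j ∈ J, z = x ∧' j} = {z : S | ∃ j ∈ J, z = x' ∧' j} →
      {z : S | ∃ b ∈ B, z = x' ∧' b} ⊆ {z : S | ∃ b ∈ B, z = x ∧' b} := by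
    rintro x hx x' hx' h z ⟨c, hc, rfl⟩
    have h1 : x' ∈ {z : S | ∃ j ∈ J, z = x' ∧' j} :=
      ⟨_, aux_class hJ hj (aux_joinL (AJ x' hx' _ hj)), (absorb₁ _ _).symm⟩
    rw [← h] at h1
    obtain ⟨j, hj', e⟩ := h1
    exact ⟨j ∧' c, aux_class hB hc (aux_meetL (BJ c hc j hj')), by rw [← meet_assoc, ← e]⟩
  exact ⟨fun h => Set.Subset.antisymm (key1 x' hx' x hx h.symm) (key1 x hx x' hx' h),
    fun h => Set.Subset.antisymm (key2 x' hx' x hx h.symm) (key2 x hx x' hx' h)⟩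

end SkewLattice
end
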